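/- arXiv:1411.2133 — 4 statements merged into one kernel-verified Lean document; each statement's English description precedes it below -/
import Mathlib

section
/- Define N(τ) = Σ_{k∈ℕ, k²−k+1<τ} (2k+1) for real τ. Then for every real τ > 16 one has (3/4)·√τ ≤ N(τ) − τ ≤ 4·√τ. -/
open Filter Topology

theorem sphere_counting_remainder_bounds (τ : ℝ) (hτ : 16 < τ) :
    3 / 4 * Real.sqrt τ ≤
        (∑' k : {k : ℕ | ((k : ℝ) ^ 2 - (k : ℝ) + 1) < τ}, (2 * ((k : ℕ) : ℝ) + 1)) - τ ∧
    (∑' k : {k : ℕ | ((k : ℝ) ^ 2 - (k : ℝ) + 1) < τ}, (2 * ((k : ℕ) : ℝ) + 1)) - τ ≤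
        4 * Real.sqrt τ := by
  classical
  have hex : ∃ n : ℕ, τ ≤ (n : ℝ) ^ 2 + n + 1 := by
    obtain ⟨n, hn⟩ := exists_nat_ge τ
    exact ⟨n, by nlinarith [sq_nonneg (n : ℝ)]⟩
  obtain ⟨m, hm, hlow⟩ : ∃ m : ℕ, τ ≤ (m : ℝ) ^ 2 + m + 1 ∧ (m : ℝ) ^ 2 - m + 1 < τ := by
    refine ⟨Nat.find hex, Nat.find_spec hex, ?_⟩
    rcases h : Nat.find hex with _ | j
    · norm_num
      linarith
    · have h2 := Nat.find_min hex (m := j) (by omega)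
      push Not at h2
      push_cast
      nlinarith
  have hm3 : (3 : ℝ) ≤ m := by
    by_contra hc
    push Not at hc
    nlinarith [Nat.cast_nonneg (α := ℝ) m]
  have hset : {k : ℕ | ((k : ℝ) ^ 2 - (k : ℝ) + 1) < τ} = ↑(Finset.range (m + 1)) := by
    ext k
    simp only [Set.mem_setOf_eq, Finset.coe_range, Set.mem_Iio]
    constructor
    · intro hk
      by_contra hc
      have h1 : (m : ℝ) + 1 ≤ k := by exact_mod_cast not_lt.mp hc
      nlinarith
    · intro hk
      have h1 : (k : ℝ) ≤ m := by exact_mod_cast Nat.lt_succ_iff.mp hk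
      rcases Nat.eq_zero_or_pos k with h0 | h0
      · subst h0
        norm_num
        linarith
      · have h2 : (1 : ℝ) ≤ k := by exact_mod_cast h0
        nlinarith
  have hs : ∀ n : ℕ, ∑ k ∈ Finset.range n, (2 * (k : ℝ) + 1) = (n : ℝ) ^ 2 := by
    intro n
    induction n with
    | zero => simp
    | succ n ih =>
      rw [Finset.sum_range_succ, ih]
      push_cast
      ring
  have hsum : (∑' k : {k : ℕ | ((k : ℝ) ^ 2 - (k : ℝ) + 1) < τ}, (2 * ((k : ℕ) : ℝ) + 1))
      = ((m : ℝ) + 1) ^ 2 := by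
    rw [hset]
    have h := Finset.tsum_subtype' (Finset.range (m + 1)) (fun k : ℕ => 2 * (k : ℝ) + 1)
    refine h.trans ?_
    rw [hs]
    push_cast
    rfl
  rw [hsum]
  have hu : Real.sqrt τ ≤ 4 / 3 * m := by
    apply Real.sqrt_le_iff.mpr
    constructor
    · positivity
    · nlinarith
  have hl : 3 / 4 * (m : ℝ) ≤ Real.sqrt τ := by
    apply Real.le_sqrt_of_sq_le
    nlinarith [sq_nonneg ((m : ℝ) - 8 / 7)]
  constructor <;> nlinarith
end

section
/- Define N_C(τ) = Σ_{(k,n)∈ℕ², (k²−k+1)(n²+1)<τ} 2(2k+1) and Z = Σ_{n∈ℕ} 2(n²+1)^{−1}. Then limsup_{τ→+∞} |N_C(τ) − Z·τ| / (τ^{1/2}·log τ) > 0. -/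
open Filter Topology

lemma exists_count (x : ℝ) (hx : 1 < x) : ∃ L : ℕ, 2 ≤ L ∧
    (∀ k : ℕ, ((k : ℝ) ^ 2 - k + 1 < x ↔ k < L)) := by
  classical
  have hex : ∃ k : ℕ, 2 ≤ k ∧ ¬ ((k : ℝ) ^ 2 - k + 1 < x) := by
    obtain ⟨n, hn⟩ := exists_nat_gt x
    refine ⟨n + 2, by omega, ?_⟩
    push_cast
    have : (0 : ℝ) ≤ n := by positivity
    nlinarith
  obtain ⟨L, ⟨h2, hL⟩, hmin⟩ : ∃ L : ℕ, (2 ≤ L ∧ ¬ ((L : ℝ) ^ 2 - L + 1 < x)) ∧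
      ∀ j < L, ¬ (2 ≤ j ∧ ¬ ((j : ℝ) ^ 2 - j + 1 < x)) :=
    ⟨Nat.find hex, Nat.find_spec hex, fun j hj => Nat.find_min hex hj⟩
  refine ⟨L, h2, fun k => ⟨fun hk => ?_, fun hk => ?_⟩⟩
  · by_contra hcon
    push Not at hcon
    apply hL
    have h2' : (2 : ℝ) ≤ L := by exact_mod_cast h2
    have h3' : (L : ℝ) ≤ k := by exact_mod_cast hcon
    nlinarith
  · have := hmin k hk
    push Not at this
    rcases Nat.lt_or_ge k 2 with h | h
    · interval_cases k <;> norm_num <;> exact hx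
    · exact this h

lemma count_bounds (x : ℝ) (hx : 1 < x) (L : ℕ) (hL : 2 ≤ L)
    (h : ∀ k : ℕ, ((k : ℝ) ^ 2 - k + 1 < x ↔ k < L)) (s : ℝ) (hs : 0 < s) (n : ℕ)
    (hxs : x * ((n : ℝ) ^ 2 + 1) = s ^ 2) :
    s * ((n : ℝ) + 1)⁻¹ / 2 ≤ (L : ℝ) ^ 2 - x ∧ (L : ℝ) ^ 2 - x ≤ 12 * (s * ((n : ℝ) + 1)⁻¹) := by
  have h1 : x ≤ (L : ℝ) ^ 2 - L + 1 := not_lt.1 (fun hh => lt_irrefl _ ((h L).1 hh))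
  have h2 := (h (L - 1)).2 (by omega)
  rw [Nat.cast_sub (by omega)] at h2
  push_cast at h2
  have hL' : (2 : ℝ) ≤ L := by exact_mod_cast hL
  have hn : (0 : ℝ) ≤ n := by positivity
  set t := s * ((n : ℝ) + 1)⁻¹ with ht
  have ht0 : 0 < t := by positivity
  have hst : s = t * (n + 1) := by rw [ht]; field_simp
  clear_value t
  have hd : (0 : ℝ) < (n : ℝ) ^ 2 + 1 := by positivity
  have hx1 : t ^ 2 ≤ x := by
    refine le_of_mul_le_mul_right ?_ hd
    rw [hxs, hst, mul_pow]
    refine mul_le_mul_of_nonneg_left ?_ (by positivity)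
    nlinarith
  have hx2 : x ≤ (2 * t) ^ 2 := by
    refine le_of_mul_le_mul_right ?_ hd
    rw [hxs, hst, mul_pow, mul_pow, mul_comm (2 ^ 2) (t ^ 2), mul_assoc]
    refine mul_le_mul_of_nonneg_left ?_ (by positivity)
    nlinarith [sq_nonneg ((n : ℝ) - 1)]
  have a1 : t ≤ L := by
    apply le_of_sq_le_sq _ (by positivity)
    nlinarith
  have a2 : 1 < 2 * t := by nlinarith
  have a3 : (L : ℝ) - 2 ≤ 2 * t := by
    apply le_of_sq_le_sq _ (by positivity)
    nlinarith
  constructor <;> nlinarith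

lemma sum_odd (L : ℕ) : ∑ k ∈ Finset.range L, 2 * (2 * (k : ℝ) + 1) = 2 * (L : ℝ) ^ 2 := by
  induction L with
  | zero => simp
  | succ n ih => rw [Finset.sum_range_succ, ih]; push_cast; ring

lemma count_eq (τ : ℝ) (M : ℕ) (hM : ∀ n : ℕ, ((n : ℝ) ^ 2 + 1 < τ ↔ n < M)) (L : ℕ → ℕ)
    (hL : ∀ n < M, ∀ k : ℕ, ((k : ℝ) ^ 2 - k + 1 < τ / ((n : ℝ) ^ 2 + 1) ↔ k < L n)) :
    (∑' q : {q : ℕ × ℕ |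
              ((q.1 : ℝ) ^ 2 - (q.1 : ℝ) + 1) * ((q.2 : ℝ) ^ 2 + 1) < τ},
            2 * (2 * (q.1.1 : ℝ) + 1)) = ∑ n ∈ Finset.range M, 2 * (L n : ℝ) ^ 2 := by
  let T : Finset (ℕ × ℕ) := ((Finset.range M).sigma fun n => Finset.range (L n)).map
    ((Equiv.sigmaEquivProd ℕ ℕ).trans (Equiv.prodComm ℕ ℕ)).toEmbedding
  have hT : {q : ℕ × ℕ | ((q.1 : ℝ) ^ 2 - (q.1 : ℝ) + 1) * ((q.2 : ℝ) ^ 2 + 1) < τ} = (T : Set (ℕ × ℕ)) := by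
    ext ⟨k, n⟩
    have hmem : (k, n) ∈ T ↔ n < M ∧ k < L n := by
      simp [T]
    rw [Finset.mem_coe, hmem]
    have hd : (0 : ℝ) < (n : ℝ) ^ 2 + 1 := by positivity
    simp only [Set.mem_ofPred_eq]
    rw [← lt_div_iff₀ hd]
    constructor
    · intro hk
      have : n < M := by
        rw [← hM]
        rw [lt_div_iff₀ hd] at hk
        have : (1 : ℝ) ≤ (k : ℝ) ^ 2 - k + 1 := by
          rcases Nat.eq_zero_or_pos k with h | h
          · simp [h]
          · have : (1 : ℝ) ≤ k := by exact_mod_cast h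
            nlinarith
        nlinarith
      exact ⟨this, (hL n this k).1 hk⟩
    · rintro ⟨h1, h2⟩
      exact (hL n h1 k).2 h2
  rw [hT]
  rw [Finset.tsum_subtype' T (fun q : ℕ × ℕ => 2 * (2 * (q.1 : ℝ) + 1))]
  simp only [T, Finset.sum_map, Finset.sum_sigma]
  refine Finset.sum_congr rfl fun n _ => ?_
  rw [← sum_odd]
  rfl

lemma summ : Summable (fun n : ℕ => 2 * ((n : ℝ) ^ 2 + 1)⁻¹) := by
  apply Summable.mul_left
  refine Summable.of_norm_bounded_eventually_nat
    (Real.summable_nat_pow_inv.2 (by norm_num : 1 < 2)) ?_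
  filter_upwards [eventually_gt_atTop 0] with n hn
  have : (0 : ℝ) < n := by exact_mod_cast hn
  rw [Real.norm_of_nonneg (by positivity)]
  gcongr
  linarith

lemma tail (M : ℕ) (hM : 2 ≤ M) :
    0 ≤ (∑' n : ℕ, 2 * (((n + M : ℕ) : ℝ) ^ 2 + 1)⁻¹) ∧
    (∑' n : ℕ, 2 * (((n + M : ℕ) : ℝ) ^ 2 + 1)⁻¹) ≤ 2 * ((M : ℝ) - 1)⁻¹ := by
  have hM' : (2 : ℝ) ≤ M := by exact_mod_cast hM
  refine ⟨tsum_nonneg fun n => by positivity, ?_⟩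
  apply Real.tsum_le_of_sum_range_le (fun n => by positivity)
  intro N
  have key : ∑ i ∈ Finset.range N, 2 * (((i + M : ℕ) : ℝ) ^ 2 + 1)⁻¹ ≤
      2 * ((M : ℝ) - 1)⁻¹ - 2 * ((M : ℝ) + N - 1)⁻¹ := by
    induction N with
    | zero => simp
    | succ N ih =>
      rw [Finset.sum_range_succ]
      have hN : (0 : ℝ) ≤ N := by positivity
      have : 2 * (((N + M : ℕ) : ℝ) ^ 2 + 1)⁻¹ ≤
          2 * ((M : ℝ) + N - 1)⁻¹ - 2 * ((M : ℝ) + (N + 1 : ℕ) - 1)⁻¹ := by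
        push_cast
        have h1 : (0 : ℝ) < M + N - 1 := by linarith
        have h2 : (0 : ℝ) < M + N := by linarith
        rw [show (M : ℝ) + (N + 1) - 1 = M + N by ring, ← mul_sub, inv_sub_inv h1.ne' h2.ne',
          inv_eq_one_div]
        rw [show (M : ℝ) + N - (M + N - 1) = 1 by ring]
        gcongr
        nlinarith
      linarith
  have : 0 ≤ 2 * ((M : ℝ) + N - 1)⁻¹ := by
    have : (0 : ℝ) ≤ N := by positivity
    have : (0 : ℝ) < M + N - 1 := by linarith
    positivity
  linarith

lemma main_bound (τ : ℝ) (hτ : 16 ≤ τ) (hlog : 16 ≤ Real.log τ) :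
    1 / 4 ≤ |(∑' q : {q : ℕ × ℕ |
              ((q.1 : ℝ) ^ 2 - (q.1 : ℝ) + 1) * ((q.2 : ℝ) ^ 2 + 1) < τ},
            2 * (2 * (q.1.1 : ℝ) + 1)) -
          (∑' n : ℕ, 2 * ((n : ℝ) ^ 2 + 1)⁻¹) * τ| /
        (τ ^ (1 / 2 : ℝ) * Real.log τ) ∧
    |(∑' q : {q : ℕ × ℕ |
              ((q.1 : ℝ) ^ 2 - (q.1 : ℝ) + 1) * ((q.2 : ℝ) ^ 2 + 1) < τ},
            2 * (2 * (q.1.1 : ℝ) + 1)) -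
          (∑' n : ℕ, 2 * ((n : ℝ) ^ 2 + 1)⁻¹) * τ| /
        (τ ^ (1 / 2 : ℝ) * Real.log τ) ≤ 52 := by
  obtain ⟨s, hs⟩ : ∃ s, s = √τ := ⟨_, rfl⟩
  have hs2 : s ^ 2 = τ := by rw [hs]; exact Real.sq_sqrt (by linarith)
  have hs4 : 4 ≤ s := by rw [hs]; apply Real.le_sqrt_of_sq_le; linarith
  obtain ⟨M, hMdef⟩ : ∃ M : ℕ, M = ⌈√(τ - 1)⌉₊ := ⟨_, rfl⟩
  have hM : ∀ n : ℕ, ((n : ℝ) ^ 2 + 1 < τ ↔ n < M) := by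
    intro n
    rw [hMdef, Nat.lt_ceil, Real.lt_sqrt (by positivity), lt_sub_iff_add_lt]
  have hM1 : s - 1 ≤ M := by
    have h1 : s - 1 ≤ √(τ - 1) := by apply Real.le_sqrt_of_sq_le; nlinarith
    rw [hMdef]; exact h1.trans (Nat.le_ceil _)
  have hM2' : (2 : ℝ) < M := by linarith
  have hM2 : 2 ≤ M := by exact_mod_cast hM2'.le
  have hM3 : (M : ℝ) ≤ τ := by
    have h1 : √(τ - 1) ≤ s := by rw [hs]; apply Real.sqrt_le_sqrt; linarith
    have := Nat.ceil_lt_add_one (Real.sqrt_nonneg (τ - 1))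
    rw [← hMdef] at this
    nlinarith
  have hx : ∀ n < M, 1 < τ / ((n : ℝ) ^ 2 + 1) := by
    intro n hn
    rw [lt_div_iff₀ (by positivity), one_mul]
    exact (hM n).2 hn
  have hex : ∀ n : ℕ, ∃ L : ℕ, n < M → 2 ≤ L ∧
      (∀ k : ℕ, ((k : ℝ) ^ 2 - k + 1 < τ / ((n : ℝ) ^ 2 + 1) ↔ k < L)) := by
    intro n
    by_cases hn : n < M
    · obtain ⟨L, h⟩ := exists_count _ (hx n hn)
      exact ⟨L, fun _ => h⟩
    · exact ⟨0, fun h => absurd h hn⟩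
  choose L hL using hex
  rw [count_eq τ M hM L (fun n hn => (hL n hn).2)]
  rw [← summ.sum_add_tsum_nat_add M]
  obtain ⟨t0, t1⟩ := tail M hM2
  set t := ∑' n : ℕ, 2 * (((n + M : ℕ) : ℝ) ^ 2 + 1)⁻¹
  rw [← Real.sqrt_eq_rpow, ← hs]
  set l := Real.log τ with hl
  set H := ∑ n ∈ Finset.range M, ((n : ℝ) + 1)⁻¹ with hH
  have hHh : H = ((harmonic M : ℚ) : ℝ) := by simp [harmonic, hH]
  have hH1 : l / 2 ≤ H := by
    rw [hHh]
    refine le_trans ?_ (log_add_one_le_harmonic M)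
    rw [hl, ← Real.log_sqrt (by linarith), ← hs]
    apply Real.log_le_log (by linarith)
    push_cast
    linarith
  have hH2 : H ≤ 1 + l := by
    rw [hHh]
    refine (harmonic_le_one_add_log M).trans ?_
    gcongr
    exact Real.log_le_log (by linarith) hM3
  have htail : t * τ ≤ 4 * s := by
    have : (M - 1 : ℝ)⁻¹ ≤ 2 * s⁻¹ := by
      rw [← one_div, div_le_iff₀ (by linarith)]
      have h : s * s⁻¹ = 1 := mul_inv_cancel₀ (by linarith)
      have h' : 0 < s⁻¹ := by positivity
      nlinarith
    calc t * τ ≤ (4 * s⁻¹) * s ^ 2 := by rw [hs2]; gcongr; linarith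
      _ = 4 * s := by field_simp
  have htail0 : 0 ≤ t * τ := by positivity
  have hR : ∀ n ∈ Finset.range M, s * ((n : ℝ) + 1)⁻¹ / 2 ≤ (L n : ℝ) ^ 2 - τ / ((n : ℝ) ^ 2 + 1) ∧
      (L n : ℝ) ^ 2 - τ / ((n : ℝ) ^ 2 + 1) ≤ 12 * (s * ((n : ℝ) + 1)⁻¹) := by
    intro n hn
    have hn' := Finset.mem_range.1 hn
    apply count_bounds _ (hx n hn') (L n) (hL n hn').1 (hL n hn').2 s (by linarith) n
    rw [hs2]
    field_simp
  have hlow := Finset.sum_le_sum (fun n hn => (hR n hn).1)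
  have hup := Finset.sum_le_sum (fun n hn => (hR n hn).2)
  rw [← Finset.sum_div, ← Finset.mul_sum] at hlow
  rw [← Finset.mul_sum, ← Finset.mul_sum] at hup
  rw [← hH] at hlow hup
  have hE : ∑ n ∈ Finset.range M, 2 * (L n : ℝ) ^ 2 -
      (∑ n ∈ Finset.range M, 2 * ((n : ℝ) ^ 2 + 1)⁻¹ + t) * τ =
      2 * ∑ n ∈ Finset.range M, ((L n : ℝ) ^ 2 - τ / ((n : ℝ) ^ 2 + 1)) - t * τ := by
    rw [add_mul, Finset.sum_mul, ← sub_sub, ← Finset.sum_sub_distrib, Finset.mul_sum]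
    congr 1
    refine Finset.sum_congr rfl fun n _ => ?_
    rw [div_eq_mul_inv]; ring
  rw [hE]
  set S := ∑ n ∈ Finset.range M, ((L n : ℝ) ^ 2 - τ / ((n : ℝ) ^ 2 + 1))
  have hpos : 0 < s * l := by positivity
  have b1 : s * (l / 2) ≤ s * H := by gcongr
  have b2 : s * H ≤ s * (1 + l) := by gcongr
  have b3 : s * 16 ≤ s * l := by gcongr
  constructor
  · rw [le_div_iff₀ hpos]
    refine le_trans ?_ (le_abs_self _)
    linarith
  · rw [div_le_iff₀ hpos, abs_le]
    constructor <;> linarith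

theorem sharpness_case_two :
    0 < Filter.limsup (fun τ : ℝ =>
        |(∑' q : {q : ℕ × ℕ |
              ((q.1 : ℝ) ^ 2 - (q.1 : ℝ) + 1) * ((q.2 : ℝ) ^ 2 + 1) < τ},
            2 * (2 * (q.1.1 : ℝ) + 1)) -
          (∑' n : ℕ, 2 * ((n : ℝ) ^ 2 + 1)⁻¹) * τ| /
        (τ ^ (1 / 2 : ℝ) * Real.log τ)) Filter.atTop := by
  have hev := (eventually_ge_atTop (16 : ℝ)).and
    (Real.tendsto_log_atTop.eventually_ge_atTop 16)
  refine lt_of_lt_of_le (by norm_num : (0 : ℝ) < 1 / 4) ?_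
  apply Filter.le_limsup_of_frequently_le
  · exact (hev.mono fun τ h => (main_bound τ h.1 h.2).1).frequently
  · exact ⟨52, by
      rw [eventually_map]
      exact hev.mono fun τ h => (main_bound τ h.1 h.2).2⟩
end

section
/- The limit lim_{τ→+∞} τ^{1/3} · Σ_{n∈ℕ, (n²+1)^{3/4} ≥ τ} (n²+1)^{−3/4} exists and equals 2. (In particular, 2·τ^{1/3}·Σ_{n∈ℕ, (n²+1)^{3/4} ≥ τ} (n²+1)^{−3/4} → 4 as τ → +∞.) -/
open Filter Topology

lemma aux_hasSum (F : ℕ → ℝ) (hF : Antitone F) (h0 : Tendsto F atTop (𝓝 0)) :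
    HasSum (fun n => F n - F (n + 1)) (F 0) := by
  rw [hasSum_iff_tendsto_nat_of_nonneg (fun n => sub_nonneg.2 (hF (Nat.le_succ n)))]
  simp_rw [Finset.sum_range_sub']
  simpa using h0.const_sub (F 0)

lemma aux_max (b c : ℝ) (hc : 0 < c) :
    Antitone (fun n : ℕ => 2 / √(max ((n : ℝ) + b) c)) ∧
    Tendsto (fun n : ℕ => 2 / √(max ((n : ℝ) + b) c)) atTop (𝓝 0) := by
  constructor
  · intro m n h
    have h' : (m : ℝ) ≤ n := by exact_mod_cast h
    have : 0 < √(max ((m : ℝ) + b) c) := Real.sqrt_pos.2 (lt_max_of_lt_right hc)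
    dsimp only
    gcongr
  · apply Tendsto.const_div_atTop
    apply Real.tendsto_sqrt_atTop.comp
    apply tendsto_atTop_mono (fun n => le_max_left _ _)
    exact tendsto_atTop_add_const_right _ _ tendsto_natCast_atTop_atTop

/-- y^(-3/2) as 1/(y √y) -/
lemma aux_pow (y : ℝ) (hy : 0 < y) : (y ^ 2) ^ (-(3 / 4 : ℝ)) = 1 / (y * √y) := by
  rw [← Real.rpow_natCast, ← Real.rpow_mul hy.le, Real.sqrt_eq_rpow]
  nth_rewrite 2 [← Real.rpow_one y]
  rw [← Real.rpow_add hy, one_div, ← Real.rpow_neg hy.le]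
  norm_num

lemma aux_up (y : ℝ) (hy : 1 < y) : 1 / (y * √y) ≤ 2 / √(y - 1) - 2 / √y := by
  have hp : 0 < √(y - 1) := Real.sqrt_pos.2 (by linarith)
  have hle : √(y - 1) ≤ √y := Real.sqrt_le_sqrt (by linarith)
  have h1 : √(y - 1) ^ 2 = y - 1 := Real.sq_sqrt (by linarith)
  have h2 : √y ^ 2 = y := Real.sq_sqrt (by linarith)
  generalize √(y - 1) = p at *
  generalize √y = q at *
  have hq : 0 < q := by linarith
  have hpq : q ^ 2 - p ^ 2 = 1 := by linarith
  have e : 2 / p - 2 / q = 2 / (p * q * (q + p)) := by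
    field_simp
    linarith
  rw [e, ← h2, div_le_div_iff₀ (by positivity) (by positivity)]
  have : p * q ≤ q * q := by gcongr
  nlinarith [mul_le_mul this (show q + p ≤ 2 * q by linarith) (by positivity) (by positivity)]

lemma aux_low (y : ℝ) (hy : 0 < y) : 2 / √y - 2 / √(y + 1) ≤ 1 / (y * √y) := by
  have hp : 0 < √y := Real.sqrt_pos.2 (by linarith)
  have hle : √y ≤ √(y + 1) := Real.sqrt_le_sqrt (by linarith)
  have h1 : √(y + 1) ^ 2 = y + 1 := Real.sq_sqrt (by linarith)
  have h2 : √y ^ 2 = y := Real.sq_sqrt (by linarith)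
  generalize √(y + 1) = q at *
  generalize √y = p at *
  have hq : 0 < q := by linarith
  have hpq : q ^ 2 - p ^ 2 = 1 := by linarith
  have e : 2 / p - 2 / q = 2 / (p * q * (q + p)) := by
    field_simp
    linarith
  rw [e, ← h2, div_le_div_iff₀ (by positivity) (by positivity)]
  have : p * p ≤ p * q := by gcongr
  nlinarith [mul_le_mul this (show 2 * p ≤ q + p by linarith) (by positivity) (by positivity)]

lemma aux_bounds (τ t : ℝ) (ht : 3 < t) (hτ : τ = (t ^ 2) ^ (3 / 4 : ℝ)) :
    2 / √(t + 2) ≤ ∑' n : {n : ℕ | τ ≤ ((n : ℝ) ^ 2 + 1) ^ (3 / 4 : ℝ)},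
          (((n : ℕ) : ℝ) ^ 2 + 1) ^ (-(3 / 4 : ℝ)) ∧
    ∑' n : {n : ℕ | τ ≤ ((n : ℝ) ^ 2 + 1) ^ (3 / 4 : ℝ)},
          (((n : ℕ) : ℝ) ^ 2 + 1) ^ (-(3 / 4 : ℝ)) ≤ 2 / √(t - 2) := by
  have hS : ∀ n : ℕ, n ∈ {n : ℕ | τ ≤ ((n : ℝ) ^ 2 + 1) ^ (3 / 4 : ℝ)} ↔
      t ^ 2 ≤ (n : ℝ) ^ 2 + 1 := by
    intro n
    rw [Set.mem_setOf_eq, hτ]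
    exact Real.rpow_le_rpow_iff (by positivity) (by positivity) (by norm_num)
  generalize {n : ℕ | τ ≤ ((n : ℝ) ^ 2 + 1) ^ (3 / 4 : ℝ)} = S at *
  rw [tsum_subtype S (fun n : ℕ => ((n : ℝ) ^ 2 + 1) ^ (-(3 / 4 : ℝ)))]
  obtain ⟨ua, ut⟩ := aux_max (-1) (t - 2) (by linarith)
  obtain ⟨la, lt⟩ := aux_max 1 (t + 2) (by linarith)
  have hu := aux_hasSum _ ua ut
  have hl := aux_hasSum _ la lt
  have e1 : max (((0 : ℕ) : ℝ) + -1) (t - 2) = t - 2 := max_eq_right (by push_cast; linarith)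
  have e2 : max (((0 : ℕ) : ℝ) + 1) (t + 2) = t + 2 := max_eq_right (by push_cast; linarith)
  rw [e1] at hu
  rw [e2] at hl
  have hn0 : ∀ n, 0 ≤ S.indicator (fun n : ℕ => ((n : ℝ) ^ 2 + 1) ^ (-(3 / 4 : ℝ))) n :=
    fun n => Set.indicator_nonneg (fun _ _ => by positivity) n
  have hup : ∀ n, S.indicator (fun n : ℕ => ((n : ℝ) ^ 2 + 1) ^ (-(3 / 4 : ℝ))) n ≤
      2 / √(max ((n : ℝ) + -1) (t - 2)) - 2 / √(max (((n + 1 : ℕ) : ℝ) + -1) (t - 2)) := by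
    intro n
    by_cases h : n ∈ S
    · rw [Set.indicator_of_mem h]
      have h' := (hS n).1 h
      have hn : (0 : ℝ) ≤ n := n.cast_nonneg
      have hnt : t - 1 ≤ n := by nlinarith
      rw [max_eq_left (by linarith), max_eq_left (by push_cast; linarith)]
      have := aux_up n (by linarith)
      rw [← aux_pow n (by linarith)] at this
      push_cast
      rw [show (n : ℝ) + 1 + -1 = n by ring, ← sub_eq_add_neg]
      refine le_trans ?_ this
      exact Real.rpow_le_rpow_of_nonpos (by nlinarith) (by linarith) (by norm_num)
    · rw [Set.indicator_of_notMem h]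
      exact sub_nonneg.2 (ua (Nat.le_succ n))
  have hlow : ∀ n : ℕ, 2 / √(max ((n : ℝ) + 1) (t + 2)) -
      2 / √(max (((n + 1 : ℕ) : ℝ) + 1) (t + 2)) ≤
      S.indicator (fun n : ℕ => ((n : ℝ) ^ 2 + 1) ^ (-(3 / 4 : ℝ))) n := by
    intro n
    have hn : (0 : ℝ) ≤ n := n.cast_nonneg
    by_cases h : (n : ℝ) ≤ t
    · rw [max_eq_right (by linarith), max_eq_right (by push_cast; linarith), sub_self]
      exact hn0 n
    · push Not at h
      have hm : n ∈ S := (hS n).2 (by nlinarith)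
      rw [Set.indicator_of_mem hm]
      have := aux_low (n + 1) (by linarith)
      rw [← aux_pow (n + 1) (by linarith)] at this
      have h3 : (((n : ℝ) + 1) ^ 2) ^ (-(3 / 4 : ℝ)) ≤ ((n : ℝ) ^ 2 + 1) ^ (-(3 / 4 : ℝ)) :=
        Real.rpow_le_rpow_of_nonpos (by positivity) (by nlinarith) (by norm_num)
      refine le_trans ?_ (this.trans h3)
      have h4 : max (((n + 1 : ℕ) : ℝ) + 1) (t + 2) = n + 1 + 1 := by
        rw [max_eq_left] <;> push_cast <;> linarith
      rw [h4]
      gcongr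
      exact le_max_left _ _
  have hs := Summable.of_nonneg_of_le hn0 hup hu.summable
  exact ⟨hasSum_le hlow hl hs.hasSum, hasSum_le hup hs.hasSum hu⟩

lemma aux_lim (c : ℝ) : Tendsto (fun t : ℝ => √t * (2 / √(t + c))) atTop (𝓝 2) := by
  have h1 : Tendsto (fun t : ℝ => 2 / √(1 + c / t)) atTop (𝓝 (2 / √(1 + 0))) := by
    apply Tendsto.div tendsto_const_nhds
    · exact (tendsto_const_nhds.add (tendsto_const_nhds.div_atTop tendsto_id)).sqrt
    · simp
  simp only [add_zero, Real.sqrt_one, div_one] at h1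
  refine h1.congr' ?_
  filter_upwards [eventually_gt_atTop 0, eventually_gt_atTop (-c)] with t ht hc
  have : 1 + c / t = (t + c) / t := by field_simp
  rw [this, Real.sqrt_div (by linarith)]
  have := Real.sqrt_pos.2 ht
  field_simp

theorem tail_sum_limit :
    Filter.Tendsto (fun τ : ℝ => τ ^ (1 / 3 : ℝ) *
        ∑' n : {n : ℕ | τ ≤ ((n : ℝ) ^ 2 + 1) ^ (3 / 4 : ℝ)},
          (((n : ℕ) : ℝ) ^ 2 + 1) ^ (-(3 / 4 : ℝ)))
      Filter.atTop (nhds 2) := by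
  have hT : Tendsto (fun τ : ℝ => τ ^ (2 / 3 : ℝ)) atTop atTop :=
    tendsto_rpow_atTop (by norm_num)
  have key : ∀ᶠ τ : ℝ in atTop, 3 < τ ^ (2 / 3 : ℝ) ∧
      τ = ((τ ^ (2 / 3 : ℝ)) ^ 2) ^ (3 / 4 : ℝ) ∧ τ ^ (1 / 3 : ℝ) = √(τ ^ (2 / 3 : ℝ)) := by
    filter_upwards [hT.eventually_gt_atTop 3, eventually_gt_atTop 0] with τ h h0
    refine ⟨h, ?_, ?_⟩
    · rw [← Real.rpow_natCast, ← Real.rpow_mul h0.le, ← Real.rpow_mul h0.le]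
      norm_num
    · rw [Real.sqrt_eq_rpow, ← Real.rpow_mul h0.le]
      norm_num
  refine tendsto_of_tendsto_of_tendsto_of_le_of_le' ((aux_lim 2).comp hT)
    ((aux_lim (-2)).comp hT) ?_ ?_
  · filter_upwards [key] with τ ⟨h1, h2, h3⟩
    rw [h3]
    exact mul_le_mul_of_nonneg_left (aux_bounds τ _ h1 h2).1 (Real.sqrt_nonneg _)
  · filter_upwards [key] with τ ⟨h1, h2, h3⟩
    rw [h3]
    exact mul_le_mul_of_nonneg_left (aux_bounds τ _ h1 h2).2 (Real.sqrt_nonneg _)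
end

section
/- The limit lim_{τ→+∞} τ^{−1/6} · Σ_{n∈ℕ, (n²+1)^{3/4} < τ} (n²+1)^{−3/8} exists and equals 4. -/
open Filter Topology

lemma quarter_aux (x : ℝ) (hx : 0 ≤ x) :
    4 * ((x + 1) ^ (1 / 4 : ℝ) - x ^ (1 / 4 : ℝ)) * (x ^ (1 / 4 : ℝ)) ^ 3 ≤ 1 ∧
    1 ≤ 4 * ((x + 1) ^ (1 / 4 : ℝ) - x ^ (1 / 4 : ℝ)) * ((x + 1) ^ (1 / 4 : ℝ)) ^ 3 := by
  have h4 : ∀ y : ℝ, 0 ≤ y → (y ^ (1 / 4 : ℝ)) ^ 4 = y := by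
    intro y hy
    rw [← Real.rpow_natCast, ← Real.rpow_mul hy]
    norm_num
  have hu := h4 (x + 1) (by linarith)
  have hv := h4 x hx
  have hle : x ^ (1 / 4 : ℝ) ≤ (x + 1) ^ (1 / 4 : ℝ) :=
    Real.rpow_le_rpow hx (by linarith) (by norm_num)
  have hv0 : 0 ≤ x ^ (1 / 4 : ℝ) := by positivity
  generalize (x + 1) ^ (1 / 4 : ℝ) = u at *
  generalize x ^ (1 / 4 : ℝ) = v at *
  obtain ⟨d, rfl⟩ : ∃ d, u = v + d := ⟨u - v, by ring⟩
  have hd : 0 ≤ d := by linarith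
  have e : (v + d) ^ 4 - v ^ 4 = 1 := by linarith
  have p1 : 0 ≤ d ^ 2 * v ^ 2 := by positivity
  have p2 : 0 ≤ d ^ 3 * v := by positivity
  have p3 : 0 ≤ d ^ 4 := by positivity
  constructor <;> nlinarith

lemma cube_quarter (y : ℝ) (hy : 0 < y) :
    y ^ (-(3 / 4 : ℝ)) * (y ^ (1 / 4 : ℝ)) ^ 3 = 1 := by
  rw [← Real.rpow_natCast, ← Real.rpow_mul hy.le, ← Real.rpow_add hy]
  norm_num

lemma sq_rpow (y : ℝ) (hy : 0 < y) : (y ^ 2) ^ (-(3 / 8 : ℝ)) = y ^ (-(3 / 4 : ℝ)) := by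
  rw [← Real.rpow_natCast, ← Real.rpow_mul hy.le]
  norm_num

lemma term_lower (n : ℕ) :
    4 * (((n : ℝ) + 1 + 1) ^ (1 / 4 : ℝ) - ((n : ℝ) + 1) ^ (1 / 4 : ℝ)) ≤
      ((n : ℝ) ^ 2 + 1) ^ (-(3 / 8 : ℝ)) := by
  have hn : (0 : ℝ) ≤ n := by positivity
  have hy : (0 : ℝ) < (n : ℝ) + 1 := by positivity
  have h := (quarter_aux ((n : ℝ) + 1) hy.le).1
  have hc := cube_quarter _ hy
  have h1 : (((n : ℝ) + 1) ^ 2) ^ (-(3 / 8 : ℝ)) ≤ ((n : ℝ) ^ 2 + 1) ^ (-(3 / 8 : ℝ)) :=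
    Real.rpow_le_rpow_of_nonpos (by positivity) (by nlinarith) (by norm_num)
  rw [sq_rpow _ hy] at h1
  refine le_trans ?_ h1
  have hp : 0 < (((n : ℝ) + 1) ^ (1 / 4 : ℝ)) ^ 3 := by positivity
  exact le_of_mul_le_mul_right (h.trans hc.ge) hp

lemma term_upper (n : ℕ) :
    (((n : ℝ) + 1) ^ 2 + 1) ^ (-(3 / 8 : ℝ)) ≤
    4 * (((n : ℝ) + 1) ^ (1 / 4 : ℝ) - (n : ℝ) ^ (1 / 4 : ℝ)) := by
  have hn : (0 : ℝ) ≤ n := by positivity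
  have hy : (0 : ℝ) < (n : ℝ) + 1 := by positivity
  have h := (quarter_aux (n : ℝ) hn).2
  have hc := cube_quarter _ hy
  have h1 : (((n : ℝ) + 1) ^ 2 + 1) ^ (-(3 / 8 : ℝ)) ≤ (((n : ℝ) + 1) ^ 2) ^ (-(3 / 8 : ℝ)) :=
    Real.rpow_le_rpow_of_nonpos (by positivity) (by linarith) (by norm_num)
  rw [sq_rpow _ hy] at h1
  refine le_trans h1 ?_
  have hp : 0 < (((n : ℝ) + 1) ^ (1 / 4 : ℝ)) ^ 3 := by positivity
  exact le_of_mul_le_mul_right (hc.le.trans h) hp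

lemma sum_lower (N : ℕ) :
    4 * (((N : ℝ) + 1) ^ (1 / 4 : ℝ) - 1) ≤
      ∑ n ∈ Finset.range N, ((n : ℝ) ^ 2 + 1) ^ (-(3 / 8 : ℝ)) := by
  induction N with
  | zero => simp
  | succ k ih =>
    rw [Finset.sum_range_succ]
    have := term_lower k
    push_cast
    linarith

lemma sum_upper (N : ℕ) :
    ∑ n ∈ Finset.range (N + 1), ((n : ℝ) ^ 2 + 1) ^ (-(3 / 8 : ℝ)) ≤
      1 + 4 * (N : ℝ) ^ (1 / 4 : ℝ) := by
  induction N with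
  | zero => simp
  | succ k ih =>
    rw [Finset.sum_range_succ]
    have := term_upper k
    push_cast
    linarith

lemma sum_bounds (τ : ℝ) (hτ : 1 < τ) :
    4 * (τ ^ (1 / 6 : ℝ) - 1) ≤
        ∑' n : {n : ℕ | ((n : ℝ) ^ 2 + 1) ^ (3 / 4 : ℝ) < τ},
          (((n : ℕ) : ℝ) ^ 2 + 1) ^ (-(3 / 8 : ℝ)) ∧
    ∑' n : {n : ℕ | ((n : ℝ) ^ 2 + 1) ^ (3 / 4 : ℝ) < τ},
          (((n : ℕ) : ℝ) ^ 2 + 1) ^ (-(3 / 8 : ℝ)) ≤ 1 + 4 * τ ^ (1 / 6 : ℝ) := by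
  have h0 : 0 < τ := by linarith
  obtain ⟨t, ht⟩ : ∃ t, t = τ ^ (2 / 3 : ℝ) := ⟨_, rfl⟩
  have ht1 : 1 < t := by rw [ht]; exact Real.one_lt_rpow hτ (by norm_num)
  have ht4 : t ^ (1 / 4 : ℝ) = τ ^ (1 / 6 : ℝ) := by
    rw [ht, ← Real.rpow_mul h0.le]; norm_num
  have htτ : τ = (t ^ 2) ^ (3 / 4 : ℝ) := by
    rw [ht, ← Real.rpow_natCast, ← Real.rpow_mul h0.le, ← Real.rpow_mul h0.le]; norm_num
  obtain ⟨N, hN⟩ : ∃ N, N = ⌈√(t ^ 2 - 1)⌉₊ := ⟨_, rfl⟩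
  have hset : {n : ℕ | ((n : ℝ) ^ 2 + 1) ^ (3 / 4 : ℝ) < τ} = ↑(Finset.range N) := by
    ext n
    simp only [Set.mem_setOf_eq, Finset.coe_range, Set.mem_Iio]
    rw [hN, Nat.lt_ceil, Real.lt_sqrt (by positivity), htτ,
      Real.rpow_lt_rpow_iff (by positivity) (by positivity) (by norm_num)]
    constructor <;> intro h <;> linarith
  rw [hset, Finset.tsum_subtype' (Finset.range N) 
    (fun n : ℕ => ((n : ℝ) ^ 2 + 1) ^ (-(3 / 8 : ℝ))), ← ht4]
  constructor
  · refine le_trans ?_ (sum_lower N)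
    have : t ≤ N + 1 := by
      have h1 : √(t ^ 2 - 1) ≤ N := hN ▸ Nat.le_ceil _
      have h2 : t - 1 ≤ √(t ^ 2 - 1) := Real.le_sqrt_of_sq_le (by nlinarith)
      linarith
    have := Real.rpow_le_rpow (by linarith) this (show (0 : ℝ) ≤ 1 / 4 by norm_num)
    linarith
  · have hpos : 0 < N := by
      rw [hN, Nat.ceil_pos]; exact Real.sqrt_pos.2 (by nlinarith)
    obtain ⟨M, rfl⟩ : ∃ M, N = M + 1 := ⟨N - 1, by omega⟩
    refine le_trans (sum_upper M) ?_
    have : (M : ℝ) ≤ t := by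
      have h1 : M < ⌈√(t ^ 2 - 1)⌉₊ := by omega
      rw [Nat.lt_ceil] at h1
      have h2 : √(t ^ 2 - 1) ≤ t := by
        rw [Real.sqrt_le_left (by linarith)]; linarith
      linarith
    have := Real.rpow_le_rpow (by positivity) this (show (0 : ℝ) ≤ 1 / 4 by norm_num)
    linarith

theorem partial_sum_limit :
    Filter.Tendsto (fun τ : ℝ => τ ^ (-(1 / 6 : ℝ)) *
        ∑' n : {n : ℕ | ((n : ℝ) ^ 2 + 1) ^ (3 / 4 : ℝ) < τ},
          (((n : ℕ) : ℝ) ^ 2 + 1) ^ (-(3 / 8 : ℝ)))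
      Filter.atTop (nhds 4) := by
  have hz : Tendsto (fun τ : ℝ => τ ^ (-(1 / 6 : ℝ))) atTop (𝓝 0) :=
    tendsto_rpow_neg_atTop (by norm_num)
  have hl : Tendsto (fun τ : ℝ => 4 - 4 * τ ^ (-(1 / 6 : ℝ))) atTop (𝓝 4) := by
    simpa using (hz.const_mul 4).const_sub 4
  have hr : Tendsto (fun τ : ℝ => 4 + τ ^ (-(1 / 6 : ℝ))) atTop (𝓝 4) := by
    simpa using hz.const_add 4
  have key : ∀ τ : ℝ, 1 < τ → τ ^ (-(1 / 6 : ℝ)) * τ ^ (1 / 6 : ℝ) = 1 := by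
    intro τ hτ
    rw [← Real.rpow_add (by linarith)]; norm_num
  refine tendsto_of_tendsto_of_tendsto_of_le_of_le' hl hr ?_ ?_
  · filter_upwards [eventually_gt_atTop 1] with τ hτ
    have hp : 0 ≤ τ ^ (-(1 / 6 : ℝ)) := Real.rpow_nonneg (by linarith) _
    have := mul_le_mul_of_nonneg_left (sum_bounds τ hτ).1 hp
    refine le_trans (le_of_eq ?_) this
    linear_combination (-4) * key τ hτ
  · filter_upwards [eventually_gt_atTop 1] with τ hτ
    have hp : 0 ≤ τ ^ (-(1 / 6 : ℝ)) := Real.rpow_nonneg (by linarith) _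
    have := mul_le_mul_of_nonneg_left (sum_bounds τ hτ).2 hp
    refine le_trans this (le_of_eq ?_)
    linear_combination 4 * key τ hτ
end
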